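/- Let Γ be a finite directed graph in which any two distinct cycles have no common vertex, and let d₁ be the maximal length of a chain of cycles in Γ. Then the number of paths in Γ of length at most n is polynomially bounded of degree d₁: there is a constant C such that for all n ≥ 1, the number of paths of length ≤ n is at most C·n^{d₁}. -/

import Mathlib

open scoped BigOperators

section LeavittSetup

variable {V E : Type}

/-- Generators of the Leavitt path algebra of a graph: vertices, edges, and ghost (star) edges. -/
inductive LGen (V E : Type) : Type
  | vert : V → LGen V E
  | edge : E → LGen V E
  | star : E → LGen V E

variable (F : Type) [Field F]

/-- The vertex generator inside the free algebra. -/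
noncomputable def gvert (v : V) : FreeAlgebra F (LGen V E) := FreeAlgebra.ι F (LGen.vert v)

/-- The edge generator inside the free algebra. -/
noncomputable def gedge (e : E) : FreeAlgebra F (LGen V E) := FreeAlgebra.ι F (LGen.edge e)

/-- The ghost edge generator `e*` inside the free algebra. -/
noncomputable def gstar (e : E) : FreeAlgebra F (LGen V E) := FreeAlgebra.ι F (LGen.star e)

variable (s r : E → V)

/-- The defining relations of the Leavitt path algebra of the graph `(V, E, s, r)`:
(1) `v * w = δ_{v,w} v`; (2) `s(e) e = e = e r(e)` and `r(e) e* = e* = e* s(e)`;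
(3) `e* f = δ_{e,f} r(e)`; (4) `v = ∑_{s(e) = v} e e*` for every non-sink `v`
(the sum makes sense whenever `v` emits finitely many edges, in particular for a
row-finite graph). -/
inductive LeavittRel : FreeAlgebra F (LGen V E) → FreeAlgebra F (LGen V E) → Prop
  | vertSelf (v : V) : LeavittRel (gvert F v * gvert F v) (gvert F v)
  | vertNe {v w : V} (h : v ≠ w) : LeavittRel (gvert F v * gvert F w) 0
  | edgeSource (e : E) : LeavittRel (gvert F (s e) * gedge F e) (gedge F e)
  | edgeRange (e : E) : LeavittRel (gedge F e * gvert F (r e)) (gedge F e)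
  | starRange (e : E) : LeavittRel (gvert F (r e) * gstar F e) (gstar F e)
  | starSource (e : E) : LeavittRel (gstar F e * gvert F (s e)) (gstar F e)
  | starEdgeSelf (e : E) : LeavittRel (gstar F e * gedge F e) (gvert F (r e))
  | starEdgeNe {e f : E} (h : e ≠ f) : LeavittRel (gstar F e * gedge F f) 0
  | ck (v : V) (h : {e : E | s e = v}.Finite) (hne : ∃ e, s e = v) :
      LeavittRel (gvert F v) (∑ e ∈ h.toFinset, gedge F e * gstar F e)

/-- The Leavitt path algebra `L(Γ)` of the graph `Γ = (V, E, s, r)` over the field `F`,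
presented as the quotient of the free algebra on the generators by the Leavitt relations. -/
noncomputable abbrev LeavittPathAlgebra := RingQuot (LeavittRel F s r)

/-- The image of a vertex in the Leavitt path algebra. -/
noncomputable def lvert (v : V) : LeavittPathAlgebra F s r :=
  RingQuot.mkAlgHom F (LeavittRel F s r) (gvert F v)

/-- The image of an edge in the Leavitt path algebra. -/
noncomputable def ledge (e : E) : LeavittPathAlgebra F s r :=
  RingQuot.mkAlgHom F (LeavittRel F s r) (gedge F e)

/-- The image of a ghost edge `e*` in the Leavitt path algebra. -/
noncomputable def lstar (e : E) : LeavittPathAlgebra F s r :=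
  RingQuot.mkAlgHom F (LeavittRel F s r) (gstar F e)

/-- The element of the Leavitt path algebra given by a path `p = e₁ ⋯ eₙ` (a list of edges). -/
noncomputable def lpath (p : List E) : LeavittPathAlgebra F s r := (p.map (ledge F s r)).prod

/-- The element `p* = eₙ* ⋯ e₁*` of the Leavitt path algebra given by a path `p = e₁ ⋯ eₙ`. -/
noncomputable def lpathStar (p : List E) : LeavittPathAlgebra F s r :=
  (p.reverse.map (lstar F s r)).prod

/-- A list of edges is a path when the range of each edge is the source of the next. -/
def IsPath (s r : E → V) (p : List E) : Prop := List.Chain' (fun e f => r e = s f) p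

/-- A nonempty path starts at the source of its first edge. -/
def StartsAt (s : E → V) (p : List E) (v : V) : Prop := ∃ e, p.head? = some e ∧ s e = v

/-- A nonempty path ends at the range of its last edge. -/
def EndsAt (r : E → V) (p : List E) (v : V) : Prop := ∃ e, p.getLast? = some e ∧ r e = v

/-- A (nonempty) closed path: it starts and ends at the same vertex. -/
def IsClosedPath (s r : E → V) (p : List E) : Prop := ∃ v, StartsAt s p v ∧ EndsAt r p v

/-- A cycle: a closed path whose source vertices are pairwise distinct.  A cycle is
identified with the subgraph it spans, i.e. with its set of edges `{e | e ∈ p}`. -/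
def IsCycle (s r : E → V) (p : List E) : Prop :=
  IsPath s r p ∧ IsClosedPath s r p ∧ (p.map s).Nodup

/-- The vertex set `V(C)` of a cycle (the sources of its edges). -/
def cycleVerts (s : E → V) (c : List E) : Set V := {v | ∃ e ∈ c, s e = v}

/-- `C ⟹ C'`: some (possibly empty) path starts at a vertex of `C` and ends at a
vertex of `C'`. -/
def CycleConnects (s r : E → V) (c c' : List E) : Prop :=
  ∃ v w, v ∈ cycleVerts s c ∧ w ∈ cycleVerts s c' ∧
    (v = w ∨ ∃ p, p ≠ [] ∧ IsPath s r p ∧ StartsAt s p v ∧ EndsAt r p w)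

/-- A chain of cycles `C₁ ⟹ C₂ ⟹ ⋯ ⟹ C_k`: pairwise distinct cycles, each connected
to the next; its length is the number of cycles. -/
def IsChainOfCycles (s r : E → V) (cs : List (List E)) : Prop :=
  (∀ c ∈ cs, IsCycle s r c) ∧ List.Chain' (CycleConnects s r) cs ∧
    List.Pairwise (fun c c' => {e | e ∈ c} ≠ {e | e ∈ c'}) cs

/-- A cycle has an exit if some edge starts at a vertex of the cycle but is not an
edge of the cycle. -/
def HasExit (s : E → V) (c : List E) : Prop := ∃ e, s e ∈ cycleVerts s c ∧ e ∉ c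

/-- A chain of cycles with an exit: the last cycle of the chain has an exit. -/
def ChainWithExit (s r : E → V) (cs : List (List E)) : Prop :=
  IsChainOfCycles s r cs ∧ ∃ c, cs.getLast? = some c ∧ HasExit s c

/-- Any two distinct cycles of the graph have no common vertex: two cycles sharing a
vertex coincide (have the same edge set). -/
def SeparatedCycles (s r : E → V) : Prop :=
  ∀ c c', IsCycle s r c → IsCycle s r c' →
    (cycleVerts s c ∩ cycleVerts s c').Nonempty → {e | e ∈ c} = {e | e ∈ c'}

/-- `W + W² + ⋯ + Wⁿ` for a subspace `W` of an `F`-algebra. -/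
noncomputable def powsSum {A : Type} [Semiring A] [Algebra F A]
    (W : Submodule F A) (n : ℕ) : Submodule F A :=
  ∑ i ∈ Finset.Icc 1 n, W ^ i


/-- Reachability by a (possibly empty) path. -/
def PReach (s r : E → V) : V → V → Prop :=
  Relation.ReflTransGen (fun a b => ∃ e, s e = a ∧ r e = b)

/-- `PWalk s r a p b`: the list `p` is a walk from `a` to `b`. -/
def PWalk (s r : E → V) : V → List E → V → Prop
  | a, [], b => a = b
  | a, e :: p, b => s e = a ∧ PWalk s r (r e) p b

/-- An edge lying on a closed walk. -/
def PCyc (s r : E → V) (e : E) : Prop := PReach s r (r e) (s e)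

theorem PReach.edge (s r : E → V) (e : E) : PReach s r (s e) (r e) :=
  Relation.ReflTransGen.single ⟨e, rfl, rfl⟩

theorem PWalk.append {s r : E → V} {p q : List E} {a b : V} :
    PWalk s r a (p ++ q) b ↔ ∃ u, PWalk s r a p u ∧ PWalk s r u q b := by
  induction p generalizing a with
  | nil => simp [PWalk]
  | cons e p ih => simp [PWalk, ih, and_assoc]

theorem PWalk.reach {s r : E → V} {p : List E} {a b : V} (h : PWalk s r a p b) :
    PReach s r a b := by
  induction p generalizing a with
  | nil => cases h; exact Relation.ReflTransGen.refl
  | cons e p ih =>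
    obtain ⟨h1, h2⟩ := h
    subst h1
    exact (PReach.edge s r e).trans (ih h2)

theorem PWalk.isPath {s r : E → V} {p : List E} {a b : V} (h : PWalk s r a p b) :
    IsPath s r p := by
  induction p generalizing a with
  | nil => exact List.isChain_nil
  | cons e p ih =>
    cases p with
    | nil => exact List.isChain_singleton _
    | cons f p =>
      exact List.isChain_cons_cons.2 ⟨h.2.1.symm, ih h.2⟩

theorem PWalk.startsAt {s r : E → V} {p : List E} {a b : V} (h : PWalk s r a p b)
    (hp : p ≠ []) : StartsAt s p a := by
  cases p with
  | nil => exact absurd rfl hp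
  | cons e p => exact ⟨e, rfl, h.1⟩

theorem PWalk.endsAt {s r : E → V} {p : List E} {a b : V} (h : PWalk s r a p b)
    (hp : p ≠ []) : EndsAt r p b := by
  induction p generalizing a with
  | nil => exact absurd rfl hp
  | cons e p ih =>
    cases p with
    | nil => exact ⟨e, rfl, h.2⟩
    | cons f p =>
      obtain ⟨g, h1, h2⟩ := ih h.2 (by simp)
      exact ⟨g, by simpa using h1, h2⟩

theorem PWalk.of_isPath {s r : E → V} {p : List E} {e : E} (h : IsPath s r (e :: p)) :
    ∃ b, PWalk s r (s e) (e :: p) b ∧ EndsAt r (e :: p) b := by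
  have : ∃ b, PWalk s r (s e) (e :: p) b := by
    induction p generalizing e with
    | nil => exact ⟨r e, rfl, rfl⟩
    | cons f p ih =>
      obtain ⟨h1, h2⟩ := List.isChain_cons_cons.1 h
      obtain ⟨b, hb⟩ := ih h2
      exact ⟨b, rfl, by rw [h1]; exact hb⟩
  obtain ⟨b, hb⟩ := this
  exact ⟨b, hb, hb.endsAt (by simp)⟩

theorem PReach.simple {s r : E → V} {a b : V} (h : PReach s r a b) :
    ∃ p, PWalk s r a p b ∧ (p.map s).Nodup ∧ b ∉ p.map s := by
  induction h using Relation.ReflTransGen.head_induction_on with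
  | refl => exact ⟨[], rfl, by simp, by simp⟩
  | head hac _ ih =>
    rename_i a c
    obtain ⟨e, rfl, rfl⟩ := hac
    obtain ⟨p, h1, h2, h3⟩ := ih
    by_cases hb : s e = b
    · exact ⟨[], hb, by simp, by simp⟩
    by_cases ha : s e ∈ p.map s
    · obtain ⟨f, hf, hfe⟩ := List.mem_map.1 ha
      obtain ⟨l, l', rfl⟩ := List.append_of_mem hf
      obtain ⟨u, _, hu⟩ := PWalk.append.1 h1
      refine ⟨f :: l', ⟨hfe, hu.2⟩, ?_, ?_⟩
      · rw [List.map_append] at h2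
        exact (List.nodup_append.1 h2).2.1
      · intro hh
        apply h3
        rw [List.map_append]
        exact List.mem_append_right _ hh
    · refine ⟨e :: p, ⟨rfl, h1⟩, ?_, ?_⟩
      · rw [List.map_cons]
        exact List.nodup_cons.2 ⟨ha, h2⟩
      · rw [List.map_cons, List.mem_cons]
        rintro (h | h)
        · exact hb h.symm
        · exact h3 h

theorem PCyc.exists_cycle {s r : E → V} {e : E} (h : PCyc s r e) :
    ∃ c, IsCycle s r c ∧ e ∈ c := by
  obtain ⟨p, h1, h2, h3⟩ := PReach.simple h
  have hw : PWalk s r (s e) (e :: p) (s e) := ⟨rfl, h1⟩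
  refine ⟨e :: p, ⟨hw.isPath, ⟨s e, hw.startsAt (by simp), hw.endsAt (by simp)⟩, ?_⟩, by simp⟩
  rw [List.map_cons]
  exact List.nodup_cons.2 ⟨h3, h2⟩

theorem IsCycle.walk {s r : E → V} {c : List E} (h : IsCycle s r c) :
    ∃ a, PWalk s r a c a := by
  obtain ⟨h1, ⟨v, ⟨e, he, hv⟩, ⟨f, hf, hv'⟩⟩, -⟩ := h
  cases c with
  | nil => simp at he
  | cons g c =>
    obtain ⟨b, hb, ⟨f', hf', hb'⟩⟩ := PWalk.of_isPath h1
    simp only [List.head?_cons, Option.some.injEq] at he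
    rw [hf] at hf'
    simp only [Option.some.injEq] at hf'
    subst he hf' hv hb'
    rw [hv'] at hb
    exact ⟨_, hb⟩

theorem IsCycle.reach {s r : E → V} {c : List E} (h : IsCycle s r c) {v w : V}
    (hv : v ∈ cycleVerts s c) (hw : w ∈ cycleVerts s c) : PReach s r v w := by
  obtain ⟨a, ha⟩ := h.walk
  have key : ∀ v ∈ cycleVerts s c, PReach s r v a ∧ PReach s r a v := by
    rintro v ⟨e, he, rfl⟩
    obtain ⟨l, l', rfl⟩ := List.append_of_mem he
    obtain ⟨u, h1, h2⟩ := PWalk.append.1 ha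
    have h3 := h2.1
    subst h3
    exact ⟨h2.reach, h1.reach⟩
  exact (key v hv).1.trans (key w hw).2

theorem PCyc.unique {s r : E → V} (hsep : SeparatedCycles s r) {e f : E} (he : PCyc s r e)
    (hf : PCyc s r f) (h : s e = s f) : e = f := by
  obtain ⟨c, hc, hec⟩ := he.exists_cycle
  obtain ⟨c', hc', hfc⟩ := hf.exists_cycle
  have hh := hsep c c' hc hc' ⟨s e, ⟨e, hec, rfl⟩, ⟨f, hfc, h.symm⟩⟩
  have hf' : f ∈ c := by
    have : f ∈ {e | e ∈ c'} := hfc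
    rw [← hh] at this
    exact this
  exact List.inj_on_of_nodup_map hc.2.2 hec hf' h

theorem PWalk.cyc_unique {s r : E → V} (hsep : SeparatedCycles s r) {p q : List E} {a b b' : V}
    (hp : PWalk s r a p b) (hq : PWalk s r a q b') (hpc : ∀ e ∈ p, PCyc s r e)
    (hqc : ∀ e ∈ q, PCyc s r e) (hl : p.length = q.length) : p = q := by
  induction p generalizing a q with
  | nil => exact (List.length_eq_zero_iff.1 hl.symm).symm
  | cons e p ih =>
    cases q with
    | nil => simp at hl
    | cons f q =>
      have hef : e = f := PCyc.unique hsep (hpc e (by simp)) (hqc f (by simp))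
        (hp.1.trans hq.1.symm)
      subst hef
      rw [ih hp.2 hq.2 (fun x hx => hpc x (by simp [hx])) (fun x hx => hqc x (by simp [hx]))
        (by simpa using hl)]

theorem PWalk.cyc_back {s r : E → V} {p : List E} {a b : V}
    (hp : PWalk s r a p b) (hpc : ∀ e ∈ p, PCyc s r e) : PReach s r b a := by
  induction p generalizing a with
  | nil => cases hp; exact Relation.ReflTransGen.refl
  | cons e p ih =>
    have h1 := hp.1
    subst h1
    exact (ih hp.2 (fun x hx => hpc x (by simp [hx]))).trans (hpc e (by simp))

/-- The paths from `v` of length at most `n`. -/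
def PathsFrom (s r : E → V) (v : V) (n : ℕ) : Set (List E) :=
  {p | (∃ b, PWalk s r v p b) ∧ p.length ≤ n}

/-- The edges leaving the strong component of `v`. -/
def PExit (s r : E → V) (v : V) : Set E :=
  {e | ¬ PCyc s r e ∧ PReach s r v (s e) ∧ PReach s r (s e) v}

/-- The empty path and the paths that start with an exit edge. -/
def PRest (s r : E → V) (v : V) (n : ℕ) : Set (List E) :=
  {[]} ∪ ⋃ e ∈ PExit s r v, (fun q => e :: q) '' PathsFrom s r (r e) n

theorem PathsFrom.finite [Fintype E] (s r : E → V) (v : V) (n : ℕ) : (PathsFrom s r v n).Finite :=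
  (List.finite_length_le E n).subset (fun _ hp => hp.2)

theorem PRest.finite [Fintype E] (s r : E → V) (v : V) (n : ℕ) : (PRest s r v n).Finite :=
  (Set.finite_singleton _).union
    ((Set.toFinite _).biUnion (fun _ _ => (PathsFrom.finite s r _ n).image _))

theorem PRest.bound [Fintype E] (s r : E → V) (v : V) (k : ℕ)
    (h : ∀ e ∈ PExit s r v, ∃ C : ℕ, ∀ n, (PathsFrom s r (r e) n).ncard ≤ C * (n + 1) ^ k) :
    ∃ C : ℕ, ∀ n, (PRest s r v n).ncard ≤ C * (n + 1) ^ k := by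
  classical
  choose! C hC using h
  set T : Finset E := (Set.toFinite (PExit s r v)).toFinset with hT
  refine ⟨1 + ∑ e ∈ T, C e, fun n => ?_⟩
  have hunion : (⋃ e ∈ PExit s r v, (fun q => e :: q) '' PathsFrom s r (r e) n) =
      ⋃ e ∈ T, (fun q => e :: q) '' PathsFrom s r (r e) n := by
    simp [hT]
  unfold PRest
  rw [hunion, add_mul, Finset.sum_mul]
  refine (Set.ncard_union_le _ _).trans (add_le_add ?_ ?_)
  · rw [Set.ncard_singleton, one_mul]
    exact Nat.one_le_pow _ _ (Nat.succ_pos n)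
  · refine (Finset.set_ncard_biUnion_le T _).trans (Finset.sum_le_sum fun e he => ?_)
    refine (Set.ncard_image_le (PathsFrom.finite s r _ n)).trans (hC e ?_ n)
    simpa [hT] using he

theorem PathsFrom.decomp {s r : E → V} {v : V} {n : ℕ} {p : List E} (hp : p ∈ PathsFrom s r v n) :
    ∃ p₁ p₂, p = p₁ ++ p₂ ∧ (∃ u, PWalk s r v p₁ u) ∧ (∀ e ∈ p₁, PCyc s r e) ∧
      p₁.length ≤ n ∧ p₂ ∈ PRest s r v n := by
  classical
  obtain ⟨⟨b, hb⟩, hl⟩ := hp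
  refine ⟨p.takeWhile (fun e => decide (PCyc s r e)), p.dropWhile (fun e => decide (PCyc s r e)),
    (List.takeWhile_append_dropWhile).symm, ?_⟩
  have hc : ∀ e ∈ p.takeWhile (fun e => decide (PCyc s r e)), PCyc s r e := by
    intro e he
    simpa using List.mem_takeWhile_imp he
  have hd : ∀ e ∈ (p.dropWhile (fun e => decide (PCyc s r e))).head?, ¬ PCyc s r e := by
    intro e he
    have := List.head?_dropWhile_not (fun e => decide (PCyc s r e)) p
    rw [Option.mem_def] at he
    rw [he] at this
    simpa using this
  have heq : p.takeWhile (fun e => decide (PCyc s r e)) ++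
    p.dropWhile (fun e => decide (PCyc s r e)) = p := List.takeWhile_append_dropWhile
  generalize p.takeWhile (fun e => decide (PCyc s r e)) = p₁ at *
  generalize p.dropWhile (fun e => decide (PCyc s r e)) = p₂ at *
  subst heq
  obtain ⟨u, h1, h2⟩ := PWalk.append.1 hb
  rw [List.length_append] at hl
  refine ⟨⟨u, h1⟩, hc, by omega, ?_⟩
  cases p₂ with
  | nil => left; rfl
  | cons e q =>
    right
    have h3 := h2.1
    subst h3
    refine Set.mem_biUnion (x := e) ⟨hd e (by simp), h1.reach, h1.cyc_back hc⟩ ?_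
    refine ⟨q, ⟨⟨b, h2.2⟩, ?_⟩, rfl⟩
    rw [List.length_cons] at hl
    omega

theorem PathsFrom.ncard_le_cyc [Fintype E] {s r : E → V} (hsep : SeparatedCycles s r) (v : V) (n : ℕ) :
    (PathsFrom s r v n).ncard ≤ (n + 1) * (PRest s r v n).ncard := by
  classical
  have h : ∀ p : List E, ∃ x : List E × List E, p ∈ PathsFrom s r v n →
      p = x.1 ++ x.2 ∧ (∃ u, PWalk s r v x.1 u) ∧ (∀ e ∈ x.1, PCyc s r e) ∧
      x.1.length ≤ n ∧ x.2 ∈ PRest s r v n := by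
    intro p
    by_cases hp : p ∈ PathsFrom s r v n
    · obtain ⟨p₁, p₂, h⟩ := PathsFrom.decomp hp
      exact ⟨(p₁, p₂), fun _ => h⟩
    · exact ⟨([], []), fun h => absurd h hp⟩
  choose g hg using h
  have h1 : (PathsFrom s r v n).ncard ≤
      ((Finset.range (n + 1) : Set ℕ) ×ˢ PRest s r v n).ncard := by
    refine Set.ncard_le_ncard_of_injOn (fun p => ((g p).1.length, (g p).2)) ?_ ?_ ?_
    · intro p hp
      obtain ⟨-, -, -, h4, h5⟩ := hg p hp
      refine ⟨?_, h5⟩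
      simp only [Finset.coe_range, Set.mem_Iio]
      omega
    · intro p hp q hq hpq
      obtain ⟨a1, ⟨u, a2⟩, a3, -, -⟩ := hg p hp
      obtain ⟨b1, ⟨u', b2⟩, b3, -, -⟩ := hg q hq
      simp only [Prod.mk.injEq] at hpq
      rw [a1, b1, hpq.2, PWalk.cyc_unique hsep a2 b2 a3 b3 hpq.1]
    · exact (Finset.finite_toSet _).prod (PRest.finite s r v n)
  rw [Set.ncard_prod, Set.ncard_coe_finset, Finset.card_range] at h1
  exact h1

theorem PathsFrom.ncard_le_acyc [Fintype E] {s r : E → V} (v : V) (n : ℕ)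
    (hv : ¬ ∃ e, s e = v ∧ PCyc s r e) :
    (PathsFrom s r v n).ncard ≤ (PRest s r v n).ncard := by
  refine Set.ncard_le_ncard ?_ (PRest.finite s r v n)
  intro p hp
  obtain ⟨p₁, p₂, h1, ⟨u, h2⟩, h3, -, h5⟩ := PathsFrom.decomp hp
  cases p₁ with
  | nil => rw [h1]; exact h5
  | cons e q => exact absurd ⟨e, h2.1, h3 e (by simp)⟩ hv

/-- A chain of cycles all of which are reachable from `v`. -/
def PChain (s r : E → V) (v : V) (cs : List (List E)) : Prop :=
  IsChainOfCycles s r cs ∧ ∀ c ∈ cs, ∃ w ∈ cycleVerts s c, PReach s r v w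

theorem PChain.cons {s r : E → V} {v : V} {c : List E} {e : E} {cs : List (List E)}
    (hc : IsCycle s r c) (hv : v ∈ cycleVerts s c) (he : e ∈ PExit s r v)
    (h : PChain s r (r e) cs) : PChain s r v (c :: cs) := by
  obtain ⟨he1, he2, he3⟩ := he
  have hvr : PReach s r v (r e) := he2.trans (PReach.edge s r e)
  obtain ⟨⟨h1, h2, h3⟩, h4⟩ := h
  refine ⟨⟨?_, ?_, ?_⟩, ?_⟩
  · intro x hx
    rcases List.mem_cons.1 hx with rfl | hx
    · exact hc
    · exact h1 x hx
  · cases cs with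
    | nil => exact List.isChain_singleton _
    | cons c' cs =>
      refine List.isChain_cons_cons.2 ⟨?_, h2⟩
      obtain ⟨w, hw, hr⟩ := h4 c' (by simp)
      refine ⟨v, w, hv, hw, ?_⟩
      obtain ⟨p, hp, -⟩ := PReach.simple (hvr.trans hr)
      by_cases hn : p = []
      · subst hn; exact Or.inl hp
      · exact Or.inr ⟨p, hn, hp.isPath, hp.startsAt hn, hp.endsAt hn⟩
  · refine List.pairwise_cons.2 ⟨?_, h3⟩
    intro c' hc' heq
    obtain ⟨w, ⟨f, hf, hfw⟩, hr⟩ := h4 c' hc'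
    have hf' : f ∈ c := by
      have : f ∈ {e | e ∈ c'} := hf
      rw [← heq] at this
      exact this
    exact he1 ((hr.trans (hc.reach ⟨f, hf', hfw⟩ hv)).trans he2)
  · intro x hx
    rcases List.mem_cons.1 hx with rfl | hx
    · exact ⟨v, hv, Relation.ReflTransGen.refl⟩
    · obtain ⟨w, hw, hr⟩ := h4 x hx
      exact ⟨w, hw, hvr.trans hr⟩

theorem PChain.nil (s r : E → V) (v : V) : PChain s r v [] :=
  ⟨⟨by simp, List.isChain_nil, List.Pairwise.nil⟩, by simp⟩

theorem PChain.mono {s r : E → V} {v w : V} (h : PReach s r v w) {cs : List (List E)}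
    (hc : PChain s r w cs) : PChain s r v cs :=
  ⟨hc.1, fun c hcs => by
    obtain ⟨x, hx, hr⟩ := hc.2 c hcs
    exact ⟨x, hx, h.trans hr⟩⟩

theorem PathsFrom.bound [Fintype E] {s r : E → V} (hsep : SeparatedCycles s r) :
    ∀ (m : ℕ) (v : V) (k : ℕ), {e | ¬ PCyc s r e ∧ PReach s r v (s e)}.ncard = m →
      (∀ cs, PChain s r v cs → cs.length ≤ k) →
      ∃ C : ℕ, ∀ n, (PathsFrom s r v n).ncard ≤ C * (n + 1) ^ k := by
  intro m
  induction m using Nat.strong_induction_on with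
  | _ m ih =>
    intro v k hm hk
    have hlt : ∀ e ∈ PExit s r v,
        {f | ¬ PCyc s r f ∧ PReach s r (r e) (s f)}.ncard < m := by
      intro e he
      rw [← hm]
      refine Set.ncard_lt_ncard ?_ (Set.toFinite _)
      refine (Set.ssubset_iff_of_subset ?_).2 ⟨e, ⟨he.1, he.2.1⟩, fun h => he.1 h.2⟩
      rintro f ⟨hf1, hf2⟩
      exact ⟨hf1, (he.2.1.trans (PReach.edge s r e)).trans hf2⟩
    by_cases hv : ∃ e, s e = v ∧ PCyc s r e
    · obtain ⟨e₀, he₀, hcyc⟩ := hv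
      obtain ⟨c, hc, hec⟩ := hcyc.exists_cycle
      have hvc : v ∈ cycleVerts s c := ⟨e₀, hec, he₀⟩
      cases k with
      | zero =>
        have : PChain s r v [c] := by
          refine ⟨⟨by simpa using hc, List.isChain_singleton _, List.pairwise_singleton _ _⟩, ?_⟩
          intro x hx
          rw [List.mem_singleton] at hx
          subst hx
          exact ⟨v, hvc, Relation.ReflTransGen.refl⟩
        have := hk _ this
        simp at this
      | succ k =>
        obtain ⟨C, hC⟩ := PRest.bound s r v k (fun e he => ih _ (hlt e he) (r e) k rfl
          (fun cs hcs => by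
            have := hk _ (PChain.cons hc hvc he hcs)
            simpa using this))
        refine ⟨C, fun n => (PathsFrom.ncard_le_cyc hsep v n).trans ?_⟩
        calc (n + 1) * (PRest s r v n).ncard ≤ (n + 1) * (C * (n + 1) ^ k) :=
              Nat.mul_le_mul_left _ (hC n)
          _ = C * (n + 1) ^ (k + 1) := by ring
    · obtain ⟨C, hC⟩ := PRest.bound s r v k (fun e he => ih _ (hlt e he) (r e) k rfl
          (fun cs hcs => hk _ (PChain.mono (he.2.1.trans (PReach.edge s r e)) hcs)))
      exact ⟨C, fun n => (PathsFrom.ncard_le_acyc v n hv).trans (hC n)⟩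

theorem IsChainOfCycles.length_le [Fintype E] {s r : E → V} {cs : List (List E)}
    (h : IsChainOfCycles s r cs) : cs.length ≤ Fintype.card (Set E) := by
  classical
  have hn : (cs.map (fun c => {e | e ∈ c})).Nodup :=
    List.pairwise_map.2 h.2.2
  have := List.Nodup.length_le_card hn
  simpa using this

/-- from the proof of Theorem 2.  In a finite graph in which
distinct cycles have no common vertex, with `d₁` the maximal length of a chain of
cycles, the number of nonempty paths of length at most `n` is bounded by `C n^{d₁}`. -/
theorem path_count_polynomial_upper_bound
    [Fintype V] [Fintype E] (hsep : SeparatedCycles s r)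
    (d₁ : ℕ)
    (hd₁ : d₁ = sSup {k : ℕ | ∃ cs, IsChainOfCycles s r cs ∧ cs.length = k}) :
    ∃ C : ℝ, ∀ n : ℕ, 1 ≤ n →
      ({p : List E | IsPath s r p ∧ p ≠ [] ∧ p.length ≤ n}.ncard : ℝ) ≤
        C * (n : ℝ) ^ d₁ := by
  classical
  have hchain : ∀ cs, IsChainOfCycles s r cs → cs.length ≤ d₁ := by
    intro cs hcs
    rw [hd₁]
    refine le_csSup ⟨Fintype.card (Set E), ?_⟩ ⟨cs, hcs, rfl⟩
    rintro k ⟨cs', h, rfl⟩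
    exact h.length_le
  have hb : ∀ v : V, ∃ C : ℕ, ∀ n, (PathsFrom s r v n).ncard ≤ C * (n + 1) ^ d₁ := fun v =>
    PathsFrom.bound hsep _ v d₁ rfl (fun cs hcs => hchain cs hcs.1)
  choose C hC using hb
  refine ⟨((∑ v, C v) * 2 ^ d₁ : ℕ), fun n hn => ?_⟩
  have h1 : {p : List E | IsPath s r p ∧ p ≠ [] ∧ p.length ≤ n} ⊆
      ⋃ v ∈ (Finset.univ : Finset V), PathsFrom s r v n := by
    rintro p ⟨hp, hne, hl⟩
    cases p with
    | nil => exact absurd rfl hne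
    | cons e p =>
      obtain ⟨b, hb, -⟩ := PWalk.of_isPath hp
      exact Set.mem_biUnion (x := s e) (by simp) ⟨⟨b, hb⟩, hl⟩
  have h2 : {p : List E | IsPath s r p ∧ p ≠ [] ∧ p.length ≤ n}.ncard ≤
      ((∑ v, C v) * 2 ^ d₁) * n ^ d₁ := by
    refine (Set.ncard_le_ncard h1 ?_).trans ((Finset.set_ncard_biUnion_le _ _).trans ?_)
    · exact (Finset.finite_toSet _).biUnion (fun v _ => PathsFrom.finite s r v n)
    · refine (Finset.sum_le_sum fun v _ => hC v n).trans ?_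
      rw [← Finset.sum_mul, mul_assoc, ← mul_pow]
      exact Nat.mul_le_mul_left _ (Nat.pow_le_pow_left (by omega) _)
  exact_mod_cast h2

end LeavittSetup
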